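/- arXiv:2011.14463 — 6 statements merged into one kernel-verified Lean document; each statement's English description precedes it below -/
import Mathlib

section
/- Assume s and t are connected in G and σ(s) = σ(t) = ∅. Then a set of colors C is a color-hitting set if and only if there exists a walk π in G from s to t such that σ(π) ⊆ C. -/
/-- The host vertex set `V(S)` of a set of colors `S`: vertices carrying a color of `S`. -/
def hostSet {V : Type} {m : ℕ} (σ : V → Finset (Fin m)) (S : Finset (Fin m)) : Set V :=
  {v | (σ v ∩ S).Nonempty}

/-- `S` is an `s`-`t` color separator. -/
def IsColorSeparator {V : Type} {m : ℕ} (G : SimpleGraph V) (σ : V → Finset (Fin m))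
    (s t : V) (S : Finset (Fin m)) : Prop :=
  ∃ (hs : s ∈ (hostSet σ S)ᶜ) (ht : t ∈ (hostSet σ S)ᶜ),
    ¬ (G.induce (hostSet σ S)ᶜ).Reachable ⟨s, hs⟩ ⟨t, ht⟩

/-- The set of colors appearing on a walk `π`. -/
def walkColors {V : Type} [DecidableEq V] {m : ℕ} {G : SimpleGraph V} {s t : V}
    (σ : V → Finset (Fin m)) (π : G.Walk s t) : Finset (Fin m) :=
  π.support.toFinset.biUnion σ

/-- `C` is a color-hitting set: it intersects every `s`-`t` color separator. -/
def IsColorHittingSet {V : Type} {m : ℕ} (G : SimpleGraph V) (σ : V → Finset (Fin m))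
    (s t : V) (C : Finset (Fin m)) : Prop :=
  ∀ S : Finset (Fin m), IsColorSeparator G σ s t S → (C ∩ S).Nonempty

/-- A color set `C` hits all `s`-`t` color separators iff there is an `s`-`t` walk
all of whose colors lie in `C`. -/
theorem colorHitting_iff_exists_walk {V : Type} [Fintype V] [DecidableEq V] {m : ℕ}
    (G : SimpleGraph V) (σ : V → Finset (Fin m)) (s t : V)
    (hreach : G.Reachable s t) (hσs : σ s = ∅) (hσt : σ t = ∅)
    (C : Finset (Fin m)) :
    IsColorHittingSet G σ s t C ↔ ∃ π : G.Walk s t, walkColors σ π ⊆ C := by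
  constructor
  · intro h
    by_contra hno
    have hs : s ∈ (hostSet σ Cᶜ)ᶜ := by simp [hostSet, hσs]
    have ht : t ∈ (hostSet σ Cᶜ)ᶜ := by simp [hostSet, hσt]
    have hsep : IsColorSeparator G σ s t Cᶜ := by
      refine ⟨hs, ht, ?_⟩
      rintro ⟨w⟩
      apply hno
      refine ⟨w.map (SimpleGraph.Embedding.induce _).toHom, ?_⟩
      intro c hc
      simp only [walkColors, Finset.mem_biUnion, List.mem_toFinset] at hc
      obtain ⟨u, hu, hcv⟩ := hc
      erw [SimpleGraph.Walk.support_map] at hu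
      obtain ⟨v, _, rfl⟩ := List.mem_map.1 hu
      by_contra hcC
      exact v.2 ⟨c, Finset.mem_inter.2 ⟨hcv, Finset.mem_compl.2 hcC⟩⟩
    obtain ⟨c, hc⟩ := h _ hsep
    simp at hc
  · rintro ⟨π, hπ⟩ S ⟨hs, ht, hsep⟩
    by_contra hne
    apply hsep
    refine ⟨π.induce _ ?_⟩
    rintro v hv ⟨c, hc⟩
    rw [Finset.mem_inter] at hc
    refine hne ⟨c, Finset.mem_inter.2 ⟨hπ ?_, hc.2⟩⟩
    exact Finset.mem_biUnion.2 ⟨v, List.mem_toFinset.2 hv, hc.1⟩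
end

section
/- Assume s and t are connected in G and σ(s) = σ(t) = ∅. Then the minimum, over all walks π from s to t, of the number |σ(π)| of distinct colors on π equals the minimum cardinality of a color-hitting set. In particular, if π* is a walk from s to t minimizing |σ(π)| and C* is a color-hitting set of minimum cardinality, then |σ(π*)| = |C*|. -/
/-- The minimum number of colors on an `s`-`t` walk equals the minimum cardinality of a
color-hitting set: if `π*` is a min-color `s`-`t` walk and `C*` is a minimum-cardinality
color-hitting set, then `|σ(π*)| = |C*|`. -/
theorem minColorWalk_card_eq_minHittingSet_card {V : Type} [Fintype V] [DecidableEq V] {m : ℕ}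
    (G : SimpleGraph V) (σ : V → Finset (Fin m)) (s t : V)
    (hreach : G.Reachable s t) (hσs : σ s = ∅) (hσt : σ t = ∅)
    (πstar : G.Walk s t)
    (hπmin : ∀ π : G.Walk s t, (walkColors σ πstar).card ≤ (walkColors σ π).card)
    (Cstar : Finset (Fin m))
    (hCstar : IsColorHittingSet G σ s t Cstar)
    (hCmin : ∀ C : Finset (Fin m), IsColorHittingSet G σ s t C → Cstar.card ≤ C.card) :
    (walkColors σ πstar).card = Cstar.card := by
  apply le_antisymm
  · have hs : s ∈ (hostSet σ (Cstarᶜ))ᶜ := by simp [hostSet, hσs]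
    have ht : t ∈ (hostSet σ (Cstarᶜ))ᶜ := by simp [hostSet, hσt]
    have hr : (G.induce (hostSet σ (Cstarᶜ))ᶜ).Reachable ⟨s, hs⟩ ⟨t, ht⟩ := by
      by_contra hn
      have := hCstar (Cstarᶜ) ⟨hs, ht, hn⟩
      simp at this
    obtain ⟨p⟩ := hr
    let q : G.Walk s t := p.map (SimpleGraph.Embedding.induce _).toHom
    refine (hπmin q).trans (Finset.card_le_card ?_)
    intro c hc
    simp only [walkColors, Finset.mem_biUnion, List.mem_toFinset] at hc
    obtain ⟨v, hv, hcv⟩ := hc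
    have hv' : v ∈ (p.map (SimpleGraph.Embedding.induce _).toHom).support := hv
    rw [SimpleGraph.Walk.support_map, List.mem_map] at hv'
    obtain ⟨w, _, rfl⟩ := hv'
    by_contra hcC
    exact w.2 ⟨c, Finset.mem_inter.2 ⟨hcv, Finset.mem_compl.2 hcC⟩⟩
  · apply hCmin
    rintro S ⟨hs, ht, hn⟩
    by_contra hne
    apply hn
    have h : ∀ v ∈ πstar.support, v ∈ (hostSet σ S)ᶜ := by
      rintro v hv ⟨c, hc⟩
      rw [Finset.mem_inter] at hc
      exact hne ⟨c, Finset.mem_inter.2 ⟨Finset.mem_biUnion.2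
        ⟨v, List.mem_toFinset.2 hv, hc.1⟩, hc.2⟩⟩
    exact ⟨πstar.induce _ h⟩
end

section
/- Assume s and t are connected in G and σ(s) = σ(t) = ∅. Then a set of colors C is a color-hitting set if and only if s and t are connected in the subgraph of G induced on the vertex set {v : σ(v) ⊆ C}. -/
/-- A color set `C` is a color-hitting set iff `s` and `t` are connected in the subgraph
induced on the vertices all of whose colors lie in `C`. -/
theorem colorHitting_iff_reachable_induced {V : Type} [Fintype V] [DecidableEq V] {m : ℕ}
    (G : SimpleGraph V) (σ : V → Finset (Fin m)) (s t : V)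
    (hreach : G.Reachable s t) (hσs : σ s = ∅) (hσt : σ t = ∅)
    (C : Finset (Fin m)) :
    IsColorHittingSet G σ s t C ↔
      (G.induce {v | σ v ⊆ C}).Reachable
        ⟨s, by simp [Set.mem_setOf_eq, hσs]⟩ ⟨t, by simp [Set.mem_setOf_eq, hσt]⟩ := by
  constructor
  · intro h
    have key : ∀ v, v ∈ (hostSet σ Cᶜ)ᶜ → v ∈ {v | σ v ⊆ C} := by
      intro v hv a ha
      by_contra hc
      exact hv ⟨a, by simp [ha, hc]⟩
    by_contra hn
    have hsep : IsColorSeparator G σ s t Cᶜ := by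
      refine ⟨by simp [hostSet, hσs], by simp [hostSet, hσt], fun hr => hn ?_⟩
      exact hr.map (G.induceHomOfLE key).toHom
    obtain ⟨a, ha⟩ := h _ hsep
    simp at ha
  · rintro h S ⟨hs, ht, hS⟩
    by_contra hC
    have key : ∀ v, v ∈ {v | σ v ⊆ C} → v ∈ (hostSet σ S)ᶜ := by
      rintro v hv ⟨a, ha⟩
      rw [Finset.mem_inter] at ha
      exact hC ⟨a, Finset.mem_inter.2 ⟨hv ha.1, ha.2⟩⟩
    exact hS (h.map (G.induceHomOfLE key).toHom)
end

section
/- Let S₁, …, S_k be s-t color separators that are pairwise disjoint as sets of colors (no color appears in two different separators). Then every walk π in G from s to t satisfies |σ(π)| ≥ k; that is, the minimum number of colors on an s-t walk is at least the number of pairwise color-disjoint s-t color separators. -/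
/-- Given `k` pairwise color-disjoint `s`-`t` color separators, every `s`-`t` walk
uses at least `k` colors. -/
theorem disjoint_separators_lower_bound {V : Type} [Fintype V] [DecidableEq V] {m k : ℕ}
    (G : SimpleGraph V) (σ : V → Finset (Fin m)) (s t : V)
    (S : Fin k → Finset (Fin m))
    (hsep : ∀ i, IsColorSeparator G σ s t (S i))
    (hdisj : ∀ i j, i ≠ j → Disjoint (S i) (S j))
    (π : G.Walk s t) :
    k ≤ (walkColors σ π).card := by
  have h : ∀ i, ∃ c ∈ S i, c ∈ walkColors σ π := by
    intro i
    obtain ⟨hs, ht, hn⟩ := hsep i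
    by_contra hc
    push Not at hc
    apply hn
    have hw : ∀ v ∈ π.support, v ∈ (hostSet σ (S i))ᶜ := by
      intro v hv hv'
      obtain ⟨c, hcm⟩ := hv'
      rw [Finset.mem_inter] at hcm
      exact hc c hcm.2 (Finset.mem_biUnion.mpr ⟨v, List.mem_toFinset.mpr hv, hcm.1⟩)
    exact ⟨π.induce _ hw⟩
  choose f hf hf' using h
  have hinj : Function.Injective f := by
    intro i j hij
    by_contra hne
    exact Finset.disjoint_left.mp (hdisj i j hne) (hf i) (hij ▸ hf j)
  have := Finset.card_le_card_of_injOn (s := Finset.univ) f (fun i _ => hf' i) hinj.injOn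
  simpa using this
end

section
/- Let G be a finite simple graph and let s ≠ t be vertices of G that are connected in G. Then the maximum cardinality of a family of pairwise disjoint s-t vertex separators equals d(s,t) − 1, where d(s,t) is the graph distance between s and t. That is: (a) there exist d(s,t) − 1 pairwise disjoint s-t vertex separators, and (b) every family of pairwise disjoint s-t vertex separators has cardinality at most d(s,t) − 1. -/
/-- `X` is an `s`-`t` vertex separator: `s ∉ X`, `t ∉ X`, and `s`, `t` are not connected
in the subgraph induced on the complement of `X`. -/
def IsVertexSeparator {V : Type} (G : SimpleGraph V) (s t : V) (X : Set V) : Prop :=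
  ∃ (hs : s ∈ Xᶜ) (ht : t ∈ Xᶜ), ¬ (G.induce Xᶜ).Reachable ⟨s, hs⟩ ⟨t, ht⟩

/-- Min-max relation for shortest paths: the maximum number of pairwise disjoint
`s`-`t` vertex separators equals `d(s,t) - 1`. -/
theorem max_disjoint_separators_eq_dist_sub_one {V : Type} [Fintype V] [DecidableEq V]
    (G : SimpleGraph V) (s t : V) (hst : s ≠ t) (hreach : G.Reachable s t) :
    (∃ X : Fin (G.dist s t - 1) → Set V,
        (∀ i, IsVertexSeparator G s t (X i)) ∧
        (∀ i j, i ≠ j → Disjoint (X i) (X j))) ∧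
    (∀ (k : ℕ) (X : Fin k → Set V),
        (∀ i, IsVertexSeparator G s t (X i)) →
        (∀ i j, i ≠ j → Disjoint (X i) (X j)) →
        k ≤ G.dist s t - 1) := by
  constructor
  · refine ⟨fun i => {v | G.dist s v = i.val + 1}, ?_, ?_⟩
    · intro i
      have hi := i.isLt
      refine ⟨by simp, ?_, ?_⟩
      · simp only [Set.mem_compl_iff, Set.mem_setOf_eq]
        omega
      · rintro ⟨w⟩
        have key : ∀ (a b : ({v | G.dist s v = i.val + 1}ᶜ : Set V))
            (_ : (G.induce ({v | G.dist s v = i.val + 1}ᶜ : Set V)).Walk a b),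
            G.Reachable s a.1 → G.dist s a.1 ≤ i.val → G.dist s b.1 ≤ i.val := by
          intro a b w
          induction w with
          | nil => exact fun _ h => h
          | @cons u v x h p ih =>
            intro hr hd
            have hadj : G.Adj u.1 v.1 := h
            have h1 := hr.dist_triangle_left v.1
            have h2 := SimpleGraph.dist_eq_one_iff_adj.mpr hadj
            have h3 : G.dist s v.1 ≠ i.val + 1 := v.2
            exact ih (hr.trans hadj.reachable) (by omega)
        have := key _ _ w (SimpleGraph.Reachable.refl _) (by simp)
        simp only at this
        omega
    · intro i j hij
      rw [Set.disjoint_left]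
      intro v h1 h2
      simp only [Set.mem_setOf_eq] at h1 h2
      exact hij (Fin.ext (by omega))
  · intro k X hX hd
    obtain ⟨p, hp⟩ := hreach.exists_walk_length_eq_dist
    have hit : ∀ i, ∃ n : Fin (G.dist s t - 1), p.getVert (n.val + 1) ∈ X i := by
      intro i
      obtain ⟨hs, ht, hn⟩ := hX i
      by_contra! hc
      apply hn
      refine ⟨p.induce _ ?_⟩
      intro v hv
      obtain ⟨n, rfl, hle⟩ := SimpleGraph.Walk.mem_support_iff_exists_getVert.mp hv
      rcases n with _ | n
      · simpa using hs
      · by_cases h : n + 1 = p.length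
        · rw [h]; simpa using ht
        · exact hc ⟨n, by omega⟩
    choose f hf using hit
    have hinj : Function.Injective f := by
      intro i j hij
      by_contra hne
      have h2 := hf j
      rw [← hij] at h2
      exact Set.disjoint_left.mp (hd i j hne) (hf i) h2
    simpa using Fintype.card_le_of_injective f hinj
end

section
/- Let n ≥ 3 be a real number, let p be a real with 0 < p ≤ 1, let z, r, q be positive natural numbers, and let N be a natural number with N ≤ z^r. Suppose that e · p · (log n) · z^r ≤ q and 3 · z · log n ≤ q · log(log n), where log denotes the natural logarithm and e is Euler's number. Then the binomial tail term satisfies C(N, q) · p^q · (1 − p)^(N − q) ≤ n^(−3z), where C(N,q) is the binomial coefficient. -/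
open Real

/-- The binomial tail bound from the random subhypergraph lemma: under the stated
conditions on `n`, `p`, `z`, `r`, `q`, `N`, the probability term
`C(N,q) · p^q · (1-p)^(N-q)` is at most `n^(-3z)`. -/
theorem binomial_tail_bound (n : ℝ) (hn : 3 ≤ n) (p : ℝ) (hp0 : 0 < p) (hp1 : p ≤ 1)
    (z r q : ℕ) (hz : 0 < z) (hr : 0 < r) (hq : 0 < q)
    (N : ℕ) (hN : N ≤ z ^ r)
    (h1 : Real.exp 1 * p * Real.log n * (z : ℝ) ^ r ≤ (q : ℝ))
    (h2 : 3 * (z : ℝ) * Real.log n ≤ (q : ℝ) * Real.log (Real.log n)) :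
    (N.choose q : ℝ) * p ^ q * (1 - p) ^ (N - q) ≤ n ^ (-(3 * (z : ℤ))) := by
  have hL : 0 < Real.log n := Real.log_pos (by linarith)
  have hn0 : 0 < n := by linarith
  have hNr : (N : ℝ) ≤ (z : ℝ) ^ r := by exact_mod_cast hN
  have hE : 0 < Real.exp 1 := Real.exp_pos 1
  have hf : (0 : ℝ) < (q.factorial : ℝ) := by exact_mod_cast q.factorial_pos
  have hb : (N : ℝ) * p * (Real.exp 1 * Real.log n) ≤ q := by
    refine le_trans ?_ h1
    have : Real.exp 1 * p * Real.log n * (N : ℝ) ≤ Real.exp 1 * p * Real.log n * (z : ℝ) ^ r := by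
      gcongr
    linarith
  have hpow : ((N : ℝ) * p) ^ q * (Real.exp 1 ^ q * Real.log n ^ q) ≤ (q : ℝ) ^ q := by
    rw [← mul_pow, ← mul_pow]
    gcongr
  have hst : (q : ℝ) ^ q ≤ Real.exp 1 ^ q * q.factorial := by
    have h := Real.pow_div_factorial_le_exp (x := (q : ℝ)) (by positivity) q
    rw [div_le_iff₀ hf] at h
    rwa [← Real.exp_nat_mul, mul_one]
  have hch : (N.choose q : ℝ) * q.factorial ≤ (N : ℝ) ^ q := by
    have h := Nat.choose_le_pow_div (α := ℝ) q N
    rwa [le_div_iff₀ hf] at h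
  have hmain : (N.choose q : ℝ) * p ^ q * Real.log n ^ q ≤ 1 := by
    have hc : 0 < Real.exp 1 ^ q * (q.factorial : ℝ) := by positivity
    refine le_of_mul_le_mul_right ?_ hc
    calc (N.choose q : ℝ) * p ^ q * Real.log n ^ q * (Real.exp 1 ^ q * q.factorial)
        = ((N.choose q : ℝ) * q.factorial) * (p ^ q * (Real.exp 1 ^ q * Real.log n ^ q)) := by ring
      _ ≤ (N : ℝ) ^ q * (p ^ q * (Real.exp 1 ^ q * Real.log n ^ q)) := by gcongr
      _ = ((N : ℝ) * p) ^ q * (Real.exp 1 ^ q * Real.log n ^ q) := by rw [mul_pow]; ring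
      _ ≤ 1 * (Real.exp 1 ^ q * q.factorial) := by linarith
  have hnL : n ^ (3 * z) ≤ Real.log n ^ q := by
    rw [← Real.log_le_log_iff (by positivity) (by positivity), Real.log_pow, Real.log_pow]
    push_cast
    exact h2
  have hz' : n ^ (-(3 * (z : ℤ))) = (n ^ (3 * z))⁻¹ := by
    rw [zpow_neg]
    congr 1
  rw [hz', ← one_div, le_div_iff₀ (by positivity)]
  have h0 : (1 - p) ^ (N - q) ≤ 1 := pow_le_one₀ (by linarith) (by linarith)
  calc (N.choose q : ℝ) * p ^ q * (1 - p) ^ (N - q) * n ^ (3 * z)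
      ≤ (N.choose q : ℝ) * p ^ q * 1 * Real.log n ^ q := by gcongr
    _ ≤ 1 := by rw [mul_one]; exact hmain
end
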